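/- (i) The sequences (a_n, b_n) form a Bailey pair relative to 1, where a_{2n} = (1 − q^{4n}) q^{2n²−2n+1} ∑_{j=−n}^{n−1} q^{−4j²−j}, a_{2n+1} = −(1 − q^{4n+2}) q^{2n²} ∑_{j=−n}^{n} q^{−4j²−3j}, b_0 = 0, and b_n = (−1)^n q^{−C(n+1,2)+1} / ((q)_{n−1} (1 − q^{2n−1})) for n ≥ 1. (ii) The sequences (α_n, β_n) form a Bailey pair relative to q, where α_{2n} = (1/(1−q)) ( q^{2n²} ∑_{j=−n}^{n} q^{−4j²−3j} + q^{2n²+2n+1} ∑_{j=−n}^{n−1} q^{−4j²−j} ), α_{2n+1} = −(1/(1−q)) ( q^{2n²+2n+1} ∑_{j=−n−1}^{n} q^{−4j²−j} + q^{2n²+4n+2} ∑_{j=−n}^{n} q^{−4j²−3j} ), and β_n = (−1)^n q^{−n(n+3)/2} / ((q)_n (1 − q^{2n+1})). -/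

import Mathlib

/-- The indeterminate `q` of the field of formal Laurent series `ℚ((q))`. -/
noncomputable def q : LaurentSeries ℚ := HahnSeries.single 1 1

/-- The q-Pochhammer symbol `(a; b)_n = ∏_{j=0}^{n-1} (1 - a * b^j)` in `ℚ((q))`. -/
noncomputable def poch (a b : LaurentSeries ℚ) (n : ℕ) : LaurentSeries ℚ :=
  ∏ j ∈ Finset.range n, (1 - a * b ^ j)

/-- `(α, β)` is a Bailey pair relative to `a`:
`β_n = ∑_{k=0}^n α_k / ((q)_{n-k} (aq)_{n+k})` for all `n ≥ 0`. -/
def IsBaileyPair (a : LaurentSeries ℚ) (α β : ℕ → LaurentSeries ℚ) : Prop :=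
  ∀ n : ℕ, β n =
    ∑ k ∈ Finset.range (n + 1), α k / (poch q q (n - k) * poch (a * q) q (n + k))

/-- `a_{2n} = (1 - q^{4n}) q^{2n²-2n+1} ∑_{j=-n}^{n-1} q^{-4j²-j}`. -/
noncomputable def aEven (n : ℕ) : LaurentSeries ℚ :=
  (1 - q ^ (4 * n)) * q ^ (2 * n ^ 2 - 2 * n + 1) *
    ∑ j ∈ Finset.Icc (-(n : ℤ)) ((n : ℤ) - 1), q ^ (-4 * j ^ 2 - j)

/-- `a_{2n+1} = -(1 - q^{4n+2}) q^{2n²} ∑_{j=-n}^{n} q^{-4j²-3j}`. -/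
noncomputable def aOdd (n : ℕ) : LaurentSeries ℚ :=
  -((1 - q ^ (4 * n + 2)) * q ^ (2 * n ^ 2) *
    ∑ j ∈ Finset.Icc (-(n : ℤ)) (n : ℤ), q ^ (-4 * j ^ 2 - 3 * j))

/-- The sequence `a` of Proposition 2.3(i). -/
noncomputable def a (m : ℕ) : LaurentSeries ℚ :=
  if m % 2 = 0 then aEven (m / 2) else aOdd (m / 2)

/-- The sequence `b` of Proposition 2.3(i): `b_0 = 0` and
`b_n = (-1)ⁿ q^{-C(n+1,2)+1} / ((q)_{n-1} (1 - q^{2n-1}))` for `n ≥ 1`. -/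
noncomputable def b (n : ℕ) : LaurentSeries ℚ :=
  if n = 0 then 0
  else (-1) ^ n * q ^ (1 - ((n + 1).choose 2 : ℤ)) /
    (poch q q (n - 1) * (1 - q ^ (2 * n - 1)))

/-- `α_{2n} = (1/(1-q)) (q^{2n²} ∑_{j=-n}^{n} q^{-4j²-3j} + q^{2n²+2n+1} ∑_{j=-n}^{n-1} q^{-4j²-j})`. -/
noncomputable def αEven (n : ℕ) : LaurentSeries ℚ :=
  (q ^ (2 * n ^ 2) * ∑ j ∈ Finset.Icc (-(n : ℤ)) (n : ℤ), q ^ (-4 * j ^ 2 - 3 * j) +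
    q ^ (2 * n ^ 2 + 2 * n + 1) *
      ∑ j ∈ Finset.Icc (-(n : ℤ)) ((n : ℤ) - 1), q ^ (-4 * j ^ 2 - j)) / (1 - q)

/-- `α_{2n+1} = -(1/(1-q)) (q^{2n²+2n+1} ∑_{j=-n-1}^{n} q^{-4j²-j} + q^{2n²+4n+2} ∑_{j=-n}^{n} q^{-4j²-3j})`. -/
noncomputable def αOdd (n : ℕ) : LaurentSeries ℚ :=
  -((q ^ (2 * n ^ 2 + 2 * n + 1) *
      ∑ j ∈ Finset.Icc (-(n : ℤ) - 1) (n : ℤ), q ^ (-4 * j ^ 2 - j) +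
    q ^ (2 * n ^ 2 + 4 * n + 2) *
      ∑ j ∈ Finset.Icc (-(n : ℤ)) (n : ℤ), q ^ (-4 * j ^ 2 - 3 * j)) / (1 - q))

/-- The sequence `α` of Proposition 2.3(ii). -/
noncomputable def α (m : ℕ) : LaurentSeries ℚ :=
  if m % 2 = 0 then αEven (m / 2) else αOdd (m / 2)

/-- The sequence `β` of Proposition 2.3(ii):
`β_n = (-1)ⁿ q^{-n(n+3)/2} / ((q)_n (1 - q^{2n+1}))`. -/
noncomputable def β (n : ℕ) : LaurentSeries ℚ :=
  (-1) ^ n * q ^ (-(n * (n + 3) / 2 : ℤ)) / (poch q q n * (1 - q ^ (2 * n + 1)))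

/-- `1/(x;x)_m`, extended by zero to negative `m`. -/
noncomputable def invP {K : Type*} [Field K] (x : K) (m : ℤ) : K :=
  if m < 0 then 0 else (∏ j ∈ Finset.range m.toNat, (1 - x * x ^ j))⁻¹

lemma invP_neg {K : Type*} [Field K] (x : K) (m : ℤ) (h : m < 0) : invP x m = 0 := by
  simp [invP, h]

lemma invP_nat {K : Type*} [Field K] (x : K) (m : ℕ) :
    invP x (m : ℤ) = (∏ j ∈ Finset.range m, (1 - x * x ^ j))⁻¹ := by
  have : ¬ ((m : ℤ) < 0) := by omega
  simp [invP, this]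

lemma invP_step {K : Type*} [Field K] (x : K) (h1 : ∀ n : ℕ, 1 - x ^ (n + 1) ≠ 0) (m : ℤ) :
    invP x (m - 1) = (1 - x ^ m) * invP x m := by
  rcases lt_trichotomy m 0 with h | h | h
  · rw [invP_neg x m h, invP_neg x (m - 1) (by omega), mul_zero]
  · subst h
    rw [invP_neg x _ (by omega)]; simp
  · obtain ⟨n, rfl⟩ : ∃ n : ℕ, m = (n : ℤ) + 1 := ⟨(m - 1).toNat, by omega⟩
    have e1 : (n : ℤ) + 1 - 1 = (n : ℤ) := by ring
    have e2 : (n : ℤ) + 1 = ((n + 1 : ℕ) : ℤ) := by push_cast; ring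
    rw [e1, e2, invP_nat, invP_nat, Finset.prod_range_succ, zpow_natCast, mul_inv]
    have := h1 n
    have h3 : 1 - x * x ^ n = 1 - x ^ (n + 1) := by ring
    rw [h3]
    field_simp

/-- triangular exponent -/
def tri (j : ℤ) : ℤ := j * (j - 1) / 2

lemma two_tri (j : ℤ) : 2 * tri j = j * (j - 1) := by
  unfold tri
  apply Int.mul_ediv_cancel'
  rcases Int.even_or_odd' j with ⟨k, rfl | rfl⟩
  · exact ⟨k * (2 * k - 1), by ring⟩
  · exact ⟨(2 * k + 1) * k, by ring⟩

/-- The summand. -/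
noncomputable def hf {K : Type*} [Field K] (x : K) (n s j : ℤ) : K :=
  (-1) ^ j * x ^ (s * j - tri j) * (invP x (n - j) * invP x (n + j))

/-- The bilateral sum. -/
noncomputable def hS {K : Type*} [Field K] (x : K) (n : ℕ) (s : ℤ) : K :=
  ∑ j ∈ Finset.Icc (-(n : ℤ)) n, hf x n s j

lemma neg_one_zpow_neg {K : Type*} [Field K] (j : ℤ) : (-1 : K) ^ (-j) = (-1) ^ j := by
  rw [zpow_neg]
  rcases Int.even_or_odd j with h | h
  · simp [h.neg_one_zpow]
  · simp [h.neg_one_zpow]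

lemma hf_refl {K : Type*} [Field K] (x : K) (n s j : ℤ) :
    hf x n (-1 - s) (-j) = hf x n s j := by
  unfold hf
  have e : (-1 - s) * (-j) - tri (-j) = s * j - tri j := by
    have h1 := two_tri j
    have h2 := two_tri (-j)
    nlinarith
  rw [e, neg_one_zpow_neg, sub_neg_eq_add, ← sub_eq_add_neg]
  ring

lemma hS_refl {K : Type*} [Field K] (x : K) (n : ℕ) (s : ℤ) :
    hS x n (-1 - s) = hS x n s := by
  unfold hS
  refine Finset.sum_nbij' (fun j => -j) (fun j => -j) ?_ ?_ ?_ ?_ ?_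
  · intro j hj; simp only [Finset.mem_Icc] at *; omega
  · intro j hj; simp only [Finset.mem_Icc] at *; omega
  · intro j _; simp
  · intro j _; simp
  · intro j _
    have := hf_refl x n s (-j)
    rw [neg_neg] at this
    exact this

/-- Antisymmetry under `j ↦ -1-j`. -/
lemma hK_anti {K : Type*} [Field K] (x : K) (hx : x ≠ 0)
    (h1 : ∀ n : ℕ, 1 - x ^ (n + 1) ≠ 0) (n j : ℤ) :
    hf x n (-1) (-1 - j) - x ^ n * hf x n (-2) (-1 - j) =
      - (hf x n (-1) j - x ^ n * hf x n (-2) j) := by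
  have key : ∀ i : ℤ, hf x n (-1) i - x ^ n * hf x n (-2) i =
      (-1) ^ i * x ^ (-i - tri i) * (invP x (n - i - 1) * invP x (n + i)) := by
    intro i
    unfold hf
    rw [invP_step x h1 (n - i)]
    have e1 : (-1) * i - tri i = -i - tri i := by ring
    have e2 : (-2) * i - tri i = (-i - tri i) - i := by ring
    rw [e1, e2, zpow_sub₀ hx (-i - tri i) i, zpow_sub₀ hx n i]
    ring
  rw [key, key]
  have e : -(-1 - j) - tri (-1 - j) = -j - tri j := by
    have h1 := two_tri j
    have h2 := two_tri (-1 - j)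
    nlinarith
  have e3 : n - (-1 - j) - 1 = n + j := by ring
  have e4 : n + (-1 - j) = n - j - 1 := by ring
  have e5 : (-1 : K) ^ (-1 - j) = - (-1) ^ j := by
    have h2 : ((-1 : K)) ^ (-1 : ℤ) = -1 := by norm_num
    rw [sub_eq_add_neg, zpow_add₀ (by simp), neg_one_zpow_neg j, h2]
    ring
  rw [e, e3, e4, e5]
  ring

lemma hS_zero_one {K : Type*} [Field K] [CharZero K] (x : K) (hx : x ≠ 0)
    (h1 : ∀ n : ℕ, 1 - x ^ (n + 1) ≠ 0) (n : ℕ) : hS x n 0 = x ^ (n : ℤ) * hS x n 1 := by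
  have a1 : hS x n (-1) = hS x n 0 := by simpa using hS_refl x n 0
  have a2 : hS x n (-2) = hS x n 1 := by simpa using hS_refl x n 1
  rw [← a1, ← a2, ← sub_eq_zero]
  unfold hS
  rw [Finset.mul_sum, ← Finset.sum_sub_distrib]
  set g : ℤ → K := fun j => hf x n (-1) j - x ^ (n : ℤ) * hf x n (-2) j with hg
  have hanti : ∀ j, g (-1 - j) = - g j := fun j => hK_anti x hx h1 n j
  have hsub : ∑ j ∈ Finset.Icc (-(n : ℤ) - 1) n, g j = ∑ j ∈ Finset.Icc (-(n : ℤ)) n, g j := by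
    symm
    apply Finset.sum_subset
    · intro j; simp only [Finset.mem_Icc]; omega
    · intro j hj hj'
      simp only [Finset.mem_Icc] at hj hj'
      have : (n : ℤ) + j < 0 := by omega
      simp [hg, hf, invP_neg x _ this]
  have hself : ∑ j ∈ Finset.Icc (-(n : ℤ) - 1) n, g j
      = ∑ j ∈ Finset.Icc (-(n : ℤ) - 1) n, - g j := by
    refine Finset.sum_nbij' (fun j => -1 - j) (fun j => -1 - j) ?_ ?_ ?_ ?_ ?_
    · intro j hj; simp only [Finset.mem_Icc] at *; omega
    · intro j hj; simp only [Finset.mem_Icc] at *; omega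
    · intro j _; ring
    · intro j _; ring
    · intro j _
      rw [hanti, neg_neg]
  rw [Finset.sum_neg_distrib] at hself
  change ∑ j ∈ Finset.Icc (-(n : ℤ)) n, g j = 0
  rw [← hsub]
  exact self_eq_neg.mp hself

lemma hS_rec {K : Type*} [Field K] [CharZero K] (x : K) (hx : x ≠ 0)
    (h1 : ∀ n : ℕ, 1 - x ^ (n + 1) ≠ 0) (n : ℕ) :
    hS x n 0 = - x ^ ((n : ℤ) + 1) * (1 - x ^ ((n : ℤ) + 1)) * hS x (n + 1) 0 := by
  have a1 : hS x (n + 1) (-1) = hS x (n + 1) 0 := by simpa using hS_refl x (n + 1) 0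
  have a2 := hS_zero_one x hx h1 (n + 1)
  have hsub : hS x n 0 = ∑ j ∈ Finset.Icc (-((n + 1 : ℕ) : ℤ)) (n + 1 : ℕ), hf x n 0 j := by
    unfold hS
    apply Finset.sum_subset
    · intro j; simp only [Finset.mem_Icc]; omega
    · intro j hj hj'
      simp only [Finset.mem_Icc] at hj hj'
      have : (n : ℤ) + j < 0 ∨ (n : ℤ) - j < 0 := by omega
      rcases this with h | h <;> simp [hf, invP_neg x _ h]
  have key : ∀ j : ℤ, hf x n 0 j = (1 + x ^ ((n : ℤ) + 1) * x ^ ((n : ℤ) + 1)) * hf x (n + 1 : ℕ) 0 j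
      - x ^ ((n : ℤ) + 1) * (hf x (n + 1 : ℕ) (-1) j + hf x (n + 1 : ℕ) 1 j) := by
    intro j
    unfold hf
    push_cast
    have e1 : (n : ℤ) - j = (n + 1 - j) - 1 := by ring
    have e2 : (n : ℤ) + j = (n + 1 + j) - 1 := by ring
    rw [e1, e2, invP_step x h1, invP_step x h1]
    have e3 : (-1) * j - tri j = (0 * j - tri j) - j := by ring
    have e4 : 1 * j - tri j = (0 * j - tri j) + j := by ring
    rw [e3, e4, zpow_sub₀ hx (0 * j - tri j), zpow_add₀ hx (0 * j - tri j),
      zpow_sub₀ hx ((n : ℤ) + 1), zpow_add₀ hx ((n : ℤ) + 1) j]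
    have := zpow_ne_zero j hx
    field_simp
    ring
  have : hS x n 0 = (1 + x ^ ((n : ℤ) + 1) * x ^ ((n : ℤ) + 1)) * hS x (n + 1) 0
      - x ^ ((n : ℤ) + 1) * (hS x (n + 1) (-1) + hS x (n + 1) 1) := by
    rw [hsub]
    unfold hS
    rw [Finset.sum_congr rfl (fun j _ => key j), Finset.sum_sub_distrib, ← Finset.mul_sum,
      ← Finset.mul_sum, Finset.sum_add_distrib]
  push_cast at a2
  rw [this, a1]
  linear_combination a2

lemma hS_zero {K : Type*} [Field K] [CharZero K] (x : K) (hx : x ≠ 0)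
    (h1 : ∀ n : ℕ, 1 - x ^ (n + 1) ≠ 0) (n : ℕ) :
    hS x n 0 = (-1) ^ n * x ^ (- tri (n + 1)) * invP x n := by
  induction n with
  | zero => simp [hS, hf, tri, invP]
  | succ n ih =>
    have h := hS_rec x hx h1 n
    rw [ih] at h
    have hs := invP_step x h1 ((n : ℤ) + 1)
    rw [add_sub_cancel_right] at hs
    rw [hs] at h
    have hx1 := zpow_ne_zero ((n : ℤ) + 1) hx
    have hy : 1 - x ^ ((n : ℤ) + 1) ≠ 0 := by
      have := h1 n
      exact_mod_cast this
    have e : - tri ((n : ℤ) + 1) = - tri ((n : ℤ) + 1 + 1) + ((n : ℤ) + 1) := by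
      have := two_tri ((n : ℤ) + 1)
      have := two_tri ((n : ℤ) + 1 + 1)
      nlinarith
    rw [e, zpow_add₀ hx (- tri ((n : ℤ) + 1 + 1))] at h
    push_cast
    apply mul_left_cancel₀ (mul_ne_zero (neg_ne_zero.mpr hx1) hy)
    rw [← h]
    ring

lemma sum_Icc_symm {K : Type*} [Field K] (f : ℤ → K) (n : ℕ) :
    ∑ j ∈ Finset.Icc (-((n + 1 : ℕ) : ℤ)) ((n + 1 : ℕ) : ℤ), f j
      = ∑ j ∈ Finset.Icc (-(n : ℤ)) (n : ℤ), f j + (f ((n : ℤ) + 1) + f (-((n : ℤ) + 1))) := by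
  have : Finset.Icc (-((n + 1 : ℕ) : ℤ)) ((n + 1 : ℕ) : ℤ) =
      insert ((n : ℤ) + 1) (insert (-((n : ℤ) + 1)) (Finset.Icc (-(n : ℤ)) (n : ℤ))) := by
    ext j; simp only [Finset.mem_Icc, Finset.mem_insert]; omega
  rw [this, Finset.sum_insert, Finset.sum_insert]
  · ring
  · simp only [Finset.mem_Icc]; omega
  · simp only [Finset.mem_Icc, Finset.mem_insert]; omega

lemma sum_Icc_asymm {K : Type*} [Field K] (f : ℤ → K) (n : ℕ) :
    ∑ j ∈ Finset.Icc (-((n + 1 : ℕ) : ℤ)) (((n + 1 : ℕ) : ℤ) - 1), f j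
      = ∑ j ∈ Finset.Icc (-(n : ℤ)) ((n : ℤ) - 1), f j + (f (n : ℤ) + f (-((n : ℤ) + 1))) := by
  have : Finset.Icc (-((n + 1 : ℕ) : ℤ)) (((n + 1 : ℕ) : ℤ) - 1) =
      insert (n : ℤ) (insert (-((n : ℤ) + 1)) (Finset.Icc (-(n : ℤ)) ((n : ℤ) - 1))) := by
    ext j; simp only [Finset.mem_Icc, Finset.mem_insert]; omega
  rw [this, Finset.sum_insert, Finset.sum_insert]
  · ring
  · simp only [Finset.mem_Icc]; omega
  · simp only [Finset.mem_Icc, Finset.mem_insert]; omega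

lemma sum_Icc_range {K : Type*} [Field K] (f : ℤ → K) (n : ℕ) :
    ∑ j ∈ Finset.Icc (-(n : ℤ)) (n : ℤ), f j
      = f 0 + ∑ k ∈ Finset.range n, (f ((k : ℤ) + 1) + f (-((k : ℤ) + 1))) := by
  induction n with
  | zero => simp
  | succ n ih => rw [sum_Icc_symm, ih, Finset.sum_range_succ]; ring

/-- The inhomogeneous term. -/
noncomputable def dd {K : Type*} [Field K] (x : K) (k : ℕ) : K :=
  (-1) ^ k * (x ^ (1 - tri k) + x ^ (1 - tri (k + 3)))

lemma hS_one_dd {K : Type*} [Field K] (x : K) (n : ℕ) :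
    - hS x n 1 = - (invP x n * invP x n) +
      ∑ k ∈ Finset.range n, dd x k * (invP x ((n : ℤ) - 1 - k) * invP x ((n : ℤ) + 1 + k)) := by
  unfold hS
  rw [sum_Icc_range, neg_add, ← Finset.sum_neg_distrib]
  congr 1
  · simp [hf, tri]
  · apply Finset.sum_congr rfl
    intro k _
    unfold hf dd
    have e1 : 1 * ((k : ℤ) + 1) - tri ((k : ℤ) + 1) = 1 - tri k := by
      have := two_tri (k : ℤ)
      have := two_tri ((k : ℤ) + 1)
      nlinarith
    have e2 : 1 * (-((k : ℤ) + 1)) - tri (-((k : ℤ) + 1)) = 1 - tri (k + 3) := by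
      have := two_tri ((k : ℤ) + 3)
      have := two_tri (-((k : ℤ) + 1))
      nlinarith
    have e3 : (-1 : K) ^ ((k : ℤ) + 1) = - (-1) ^ k := by
      rw [zpow_add₀ (by simp)]; simp
    have e4 : (n : ℤ) - (k + 1) = n - 1 - k := by ring
    have e5 : (n : ℤ) + (k + 1) = n + 1 + k := by ring
    have e6 : (n : ℤ) - (-((k : ℤ) + 1)) = n + 1 + k := by ring
    have e7 : (n : ℤ) + (-((k : ℤ) + 1)) = n - 1 - k := by ring
    rw [e1, e2, neg_one_zpow_neg, e3, e4, e5, e6, e7]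
    ring

/-- Main abstract summation. -/
lemma main_sum {K : Type*} [Field K] [CharZero K] (x : K) (hx : x ≠ 0)
    (h1 : ∀ n : ℕ, 1 - x ^ (n + 1) ≠ 0) (c : ℕ → K) (c0 : c 0 = 0) (c1 : c 1 = -1)
    (hc : ∀ k, c (k + 2) = x ^ (2 * k) * c k + dd x k) (n : ℕ) :
    (1 - x ^ (2 * n + 1)) * ∑ k ∈ Finset.range (n + 2),
      (1 - x ^ (2 * k)) * c k * (invP x ((n : ℤ) + 1 - k) * invP x ((n : ℤ) + 1 + k))
    = (-1) ^ (n + 1) * x ^ (1 - tri ((n : ℤ) + 2)) * invP x n := by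
  have hR : (-1) ^ (n + 1) * x ^ (1 - tri ((n : ℤ) + 2)) * invP x n = - hS x n 1 := by
    have h0 := hS_zero x hx h1 n
    rw [hS_zero_one x hx h1] at h0
    have e : - tri ((n : ℤ) + 1) = n + (1 - tri ((n : ℤ) + 2)) := by
      have := two_tri ((n : ℤ) + 1)
      have := two_tri ((n : ℤ) + 2)
      nlinarith
    rw [e, zpow_add₀ hx] at h0
    apply mul_left_cancel₀ (zpow_ne_zero (n : ℤ) hx)
    rw [mul_neg, h0]
    ring
  rw [hR, hS_one_dd, Finset.mul_sum]
  set u : ℤ → K := fun k => invP x ((n : ℤ) - 1 - k) * invP x ((n : ℤ) + 1 + k) with hu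
  have key : ∀ k : ℕ, (1 - x ^ (2 * n + 1)) * ((1 - x ^ (2 * k)) * c k *
      (invP x ((n : ℤ) + 1 - k) * invP x ((n : ℤ) + 1 + k)))
      = c k * u ((k : ℤ) - 2) - x ^ (2 * k) * c k * u k := by
    intro k
    have e1 : (n : ℤ) - 1 - ((k : ℤ) - 2) = n + 1 - k := by ring
    have e2 : (n : ℤ) + 1 + ((k : ℤ) - 2) = ((n + 1 + k) - 1) - 1 := by ring
    have e3 : (n : ℤ) - 1 - k = ((n + 1 - k) - 1) - 1 := by ring
    simp only [hu]
    rw [e1, e2, e3, invP_step x h1, invP_step x h1, invP_step x h1 ((n : ℤ) + 1 - k - 1),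
      invP_step x h1 ((n : ℤ) + 1 - k)]
    simp only [zpow_add₀ hx, zpow_sub₀ hx, zpow_natCast, zpow_one]
    field_simp
    ring
  rw [Finset.sum_congr rfl (fun k _ => key k), Finset.sum_sub_distrib,
    Finset.sum_range_succ', Finset.sum_range_succ']
  rw [Finset.sum_range_succ (fun k : ℕ => x ^ (2 * k) * c k * u k),
    Finset.sum_range_succ (fun k : ℕ => x ^ (2 * k) * c k * u k)]
  have u1 : u ((n : ℕ) : ℤ) = 0 := by
    simp only [hu]; rw [invP_neg x _ (by omega), zero_mul]
  have u2 : u ((n + 1 : ℕ) : ℤ) = 0 := by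
    simp only [hu]; rw [invP_neg x _ (by push_cast; omega), zero_mul]
  have u3 : u (((0 + 1 : ℕ) : ℤ) - 2) = invP x n * invP x n := by
    simp only [hu]; norm_num
  rw [u1, u2, u3, c0]
  have hs : ∑ k ∈ Finset.range n, c (k + 1 + 1) * u (((k + 1 + 1 : ℕ) : ℤ) - 2)
      = ∑ k ∈ Finset.range n, x ^ (2 * k) * c k * u k + ∑ k ∈ Finset.range n, dd x k * u k := by
    rw [← Finset.sum_add_distrib]
    apply Finset.sum_congr rfl
    intro k _
    have e : (((k + 1 + 1 : ℕ) : ℤ) - 2) = k := by push_cast; ring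
    rw [e, hc k]; ring
  rw [hs, zero_add, c1]
  ring

/-- The common core of the sequences `a` and `α`. -/
noncomputable def cc (m : ℕ) : LaurentSeries ℚ :=
  if m % 2 = 0 then q ^ (2 * (m / 2) ^ 2 - 2 * (m / 2) + 1) *
    ∑ j ∈ Finset.Icc (-((m / 2 : ℕ) : ℤ)) (((m / 2 : ℕ) : ℤ) - 1), q ^ (-4 * j ^ 2 - j)
  else -(q ^ (2 * (m / 2) ^ 2) *
    ∑ j ∈ Finset.Icc (-((m / 2 : ℕ) : ℤ)) ((m / 2 : ℕ) : ℤ), q ^ (-4 * j ^ 2 - 3 * j))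

lemma q_ne : q ≠ 0 := by
  unfold q
  exact HahnSeries.single_ne_zero one_ne_zero

lemma q_pow (n : ℕ) : q ^ n = HahnSeries.single (n : ℤ) 1 := by
  unfold q
  rw [HahnSeries.single_pow]; simp

lemma one_sub_q (n : ℕ) : 1 - q ^ (n + 1) ≠ 0 := by
  rw [q_pow, sub_ne_zero]
  intro h
  have h2 := congrArg (fun f : LaurentSeries ℚ => f.coeff 0) h
  simp only [HahnSeries.coeff_one] at h2
  rw [HahnSeries.coeff_single_of_ne (by push_cast; omega)] at h2
  simp at h2

lemma a_eq (k : ℕ) : a k = (1 - q ^ (2 * k)) * cc k := by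
  unfold a cc aEven aOdd
  split_ifs with h
  · have : 4 * (k / 2) = 2 * k := by omega
    rw [this]; ring
  · have : 4 * (k / 2) + 2 = 2 * k := by omega
    rw [this]; ring

lemma cc_even (n : ℕ) : cc (2 * n) = q ^ (2 * (n : ℤ) ^ 2 - 2 * n + 1) *
    ∑ j ∈ Finset.Icc (-(n : ℤ)) ((n : ℤ) - 1), q ^ (-4 * j ^ 2 - j) := by
  unfold cc
  have h : 2 * n / 2 = n := by omega
  rw [if_pos (by omega), h, ← zpow_natCast]
  congr 2
  have : 2 * n ≤ 2 * n ^ 2 := by nlinarith [Nat.le_self_pow (n := 2) (by norm_num) n]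
  push_cast [Nat.cast_sub this]
  ring

lemma cc_odd (n : ℕ) : cc (2 * n + 1) = -(q ^ (2 * (n : ℤ) ^ 2) *
    ∑ j ∈ Finset.Icc (-(n : ℤ)) (n : ℤ), q ^ (-4 * j ^ 2 - 3 * j)) := by
  unfold cc
  have h : (2 * n + 1) / 2 = n := by omega
  rw [if_neg (by omega), h, ← zpow_natCast]
  push_cast
  rfl

lemma cc_rec (k : ℕ) : cc (k + 2) = q ^ (2 * k) * cc k + dd q k := by
  rcases Nat.even_or_odd' k with ⟨n, rfl | rfl⟩
  · have e : 2 * n + 2 = 2 * (n + 1) := by ring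
    rw [e, cc_even, cc_even, sum_Icc_asymm, ← zpow_natCast q (2 * (2 * n)), ← mul_assoc,
      ← zpow_add₀ q_ne, mul_add]
    congr 1
    · congr 2; push_cast; ring
    · unfold dd
      rw [mul_add, mul_add, ← zpow_add₀ q_ne, ← zpow_add₀ q_ne, pow_mul]
      simp only [even_two, Even.neg_pow, one_pow, one_mul]
      have t1 := two_tri ((2 * n : ℕ) : ℤ)
      have t2 := two_tri (((2 * n : ℕ) : ℤ) + 3)
      push_cast at t1 t2 ⊢
      congr 2
      · nlinarith
      · nlinarith
  · have e : 2 * n + 1 + 2 = 2 * (n + 1) + 1 := by ring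
    rw [e, cc_odd, cc_odd, sum_Icc_symm, ← zpow_natCast q (2 * (2 * n + 1)),
      mul_neg (q ^ ((2 * (2 * n + 1) : ℕ) : ℤ)), ← mul_assoc,
      ← zpow_add₀ q_ne, mul_add, neg_add]
    congr 1
    · congr 3; push_cast; ring
    · unfold dd
      have hm : (-1 : LaurentSeries ℚ) ^ (2 * n + 1) = -1 := by
        rw [pow_succ, pow_mul]; simp
      rw [mul_add (q ^ _), ← zpow_add₀ q_ne, ← zpow_add₀ q_ne, hm, neg_one_mul,
        add_comm (q ^ (1 - tri _))]
      apply congrArg Neg.neg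
      have t1 := two_tri ((2 * n + 1 : ℕ) : ℤ)
      have t2 := two_tri (((2 * n + 1 : ℕ) : ℤ) + 3)
      push_cast at t1 t2 ⊢
      congr 2
      · nlinarith
      · nlinarith

lemma cc_zero : cc 0 = 0 := by simp [cc]

lemma cc_one : cc 1 = -1 := by simp [cc]

lemma alpha_eq (k : ℕ) : α k = (q ^ (2 * k) * cc k - cc (k + 1)) / (1 - q) := by
  rcases Nat.even_or_odd' k with ⟨n, rfl | rfl⟩
  · rw [cc_even, cc_odd]
    unfold α αEven
    have h : 2 * n / 2 = n := by omega
    rw [if_pos (by omega), h, ← mul_assoc, ← zpow_natCast, ← zpow_natCast, ← zpow_natCast,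
      ← zpow_add₀ q_ne]
    have e : ((2 * (2 * n) : ℕ) : ℤ) + (2 * (n : ℤ) ^ 2 - 2 * n + 1)
      = ((2 * n ^ 2 + 2 * n + 1 : ℕ) : ℤ) := by push_cast; ring
    have e2 : (2 * (n : ℤ) ^ 2) = ((2 * n ^ 2 : ℕ) : ℤ) := by push_cast; ring
    rw [e, e2]
    ring
  · have e0 : 2 * n + 1 + 1 = 2 * (n + 1) := by ring
    rw [e0, cc_even, cc_odd]
    unfold α αOdd
    have h : (2 * n + 1) / 2 = n := by omega
    rw [if_neg (by omega), h, mul_neg, ← mul_assoc, ← zpow_natCast, ← zpow_natCast, ← zpow_natCast,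
      ← zpow_add₀ q_ne]
    have e : ((2 * (2 * n + 1) : ℕ) : ℤ) + (2 * (n : ℤ) ^ 2)
      = ((2 * n ^ 2 + 4 * n + 2 : ℕ) : ℤ) := by push_cast; ring
    have e2 : 2 * ((n + 1 : ℕ) : ℤ) ^ 2 - 2 * ((n + 1 : ℕ) : ℤ) + 1
      = ((2 * n ^ 2 + 2 * n + 1 : ℕ) : ℤ) := by push_cast; ring
    have e3 : -((n + 1 : ℕ) : ℤ) = -(n : ℤ) - 1 := by push_cast; ring
    have e4 : ((n + 1 : ℕ) : ℤ) - 1 = (n : ℤ) := by push_cast; ring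
    rw [e, e2, e3, e4]
    ring

lemma poch_invP (m : ℕ) : (poch q q m)⁻¹ = invP q m := by
  rw [invP_nat]; rfl

lemma poch_q2 (m : ℕ) : (1 - q) * poch (q * q) q m = poch q q (m + 1) := by
  unfold poch
  rw [Finset.prod_range_succ']
  simp only [pow_zero, mul_one]
  rw [mul_comm]
  congr 1
  apply Finset.prod_congr rfl
  intro j _
  ring

lemma charZero_laurent : CharZero (LaurentSeries ℚ) :=
  charZero_of_injective_algebraMap (algebraMap ℚ (LaurentSeries ℚ)).injective

lemma bailey_one (n : ℕ) : (1 - q ^ (2 * n + 1)) * ∑ k ∈ Finset.range (n + 2),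
      (1 - q ^ (2 * k)) * cc k * (invP q ((n : ℤ) + 1 - k) * invP q ((n : ℤ) + 1 + k))
    = (-1) ^ (n + 1) * q ^ (1 - tri ((n : ℤ) + 2)) * invP q n :=
  haveI := charZero_laurent
  main_sum q q_ne one_sub_q cc cc_zero cc_one cc_rec n

lemma tri_choose (n : ℕ) : tri n = (n.choose 2 : ℤ) := by
  have h := two_tri n
  have h2 : n.choose 2 * 2 = n * (n - 1) := by
    rw [Nat.choose_two_right]; exact Nat.div_mul_cancel (Nat.even_mul_pred_self n).two_dvd
  rcases n with _ | n
  · simp [tri]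
  · simp only [Nat.add_sub_cancel] at h2
    zify at h2
    push_cast at h h2 ⊢
    nlinarith

theorem part_one : IsBaileyPair 1 a b := by
  intro n
  rcases n with _ | n
  · simp [b, a_eq, cc_zero]
  · have hb := bailey_one n
    have hs : ∑ k ∈ Finset.range (n + 1 + 1),
        a k / (poch q q (n + 1 - k) * poch (1 * q) q (n + 1 + k)) =
        ∑ k ∈ Finset.range (n + 2),
        (1 - q ^ (2 * k)) * cc k * (invP q ((n : ℤ) + 1 - k) * invP q ((n : ℤ) + 1 + k)) := by
      apply Finset.sum_congr rfl
      intro k hk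
      rw [Finset.mem_range] at hk
      rw [a_eq, one_mul, div_eq_mul_inv, mul_inv, poch_invP, poch_invP]
      push_cast [Nat.cast_sub (show k ≤ n + 1 by omega)]
      rfl
    rw [hs]
    unfold b
    rw [if_neg (by omega)]
    have e : 2 * (n + 1) - 1 = 2 * n + 1 := by omega
    have ht := tri_choose (n + 1 + 1)
    have e2 : ((n + 1 + 1 : ℕ) : ℤ) = (n : ℤ) + 2 := by push_cast; ring
    rw [e2] at ht
    rw [e, Nat.add_sub_cancel, ← ht, div_eq_mul_inv, mul_inv, poch_invP, ← mul_assoc, ← hb]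
    have := one_sub_q (2 * n)
    field_simp

theorem part_two : IsBaileyPair q α β := by
  intro n
  have hb := bailey_one n
  have hq : 1 - q ≠ 0 := by simpa using one_sub_q 0
  set P : ℕ → LaurentSeries ℚ := fun k => invP q ((n : ℤ) - k) * invP q ((n : ℤ) + 1 + k) with hP
  set Q : ℕ → LaurentSeries ℚ := fun k => invP q ((n : ℤ) + 1 - k) * invP q ((n : ℤ) + k) with hQ
  have hs : ∑ k ∈ Finset.range (n + 1),
        α k / (poch q q (n - k) * poch (q * q) q (n + k)) =
        ∑ k ∈ Finset.range (n + 1), (q ^ (2 * k) * cc k * P k - cc (k + 1) * Q (k + 1)) := by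
    apply Finset.sum_congr rfl
    intro k hk
    rw [Finset.mem_range] at hk
    rw [alpha_eq, div_div, mul_left_comm, poch_q2, div_eq_mul_inv, mul_inv, poch_invP, poch_invP]
    simp only [hP, hQ]
    push_cast [Nat.cast_sub (show k ≤ n by omega)]
    have e1 : (n : ℤ) + 1 - (k + 1) = n - k := by ring
    have e2 : (n : ℤ) + (k + 1) = n + k + 1 := by ring
    have e3 : (n : ℤ) + 1 + k = n + k + 1 := by ring
    rw [e1, e2, e3]
    ring
  have key : ∀ k : ℕ, q ^ (2 * k) * cc k * P k - cc k * Q k =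
      - ((1 - q ^ (2 * k)) * cc k * (invP q ((n : ℤ) + 1 - k) * invP q ((n : ℤ) + 1 + k))) := by
    intro k
    simp only [hP, hQ]
    have e1 : (n : ℤ) - k = (n + 1 - k) - 1 := by ring
    have e2 : (n : ℤ) + k = (n + 1 + k) - 1 := by ring
    rw [e1, e2, invP_step q one_sub_q, invP_step q one_sub_q]
    simp only [zpow_add₀ q_ne, zpow_sub₀ q_ne, zpow_natCast, zpow_one]
    have := q_ne
    field_simp
    ring
  have hPn : P (n + 1) = 0 := by
    simp only [hP]; rw [invP_neg q _ (by push_cast; omega), zero_mul]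
  have hs2 : ∑ k ∈ Finset.range (n + 1), (q ^ (2 * k) * cc k * P k - cc (k + 1) * Q (k + 1))
      = - ∑ k ∈ Finset.range (n + 2),
      (1 - q ^ (2 * k)) * cc k * (invP q ((n : ℤ) + 1 - k) * invP q ((n : ℤ) + 1 + k)) := by
    rw [← Finset.sum_neg_distrib, ← Finset.sum_congr rfl (fun k _ => key k),
      Finset.sum_sub_distrib, Finset.sum_sub_distrib,
      Finset.sum_range_succ (fun k => q ^ (2 * k) * cc k * P k) (n + 1),
      Finset.sum_range_succ' (fun k => cc k * Q k) (n + 1), hPn, cc_zero]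
    ring
  rw [hs, hs2]
  unfold β
  have e : -((n : ℤ) * (n + 3) / 2) = 1 - tri ((n : ℤ) + 2) := by
    have h := two_tri ((n : ℤ) + 2)
    have : (n : ℤ) * (n + 3) = 2 * (tri ((n : ℤ) + 2) - 1) := by linarith
    rw [this, Int.mul_ediv_cancel_left _ (by norm_num)]
    ring
  have h2 := one_sub_q (2 * n)
  rw [e, div_eq_mul_inv, mul_inv, poch_invP]
  rw [pow_succ (-1 : LaurentSeries ℚ) n] at hb
  apply mul_left_cancel₀ h2
  rw [mul_neg, hb]
  field_simp

/-- Proposition 2.3: `(a, b)` is a Bailey pair relative to `1` and `(α, β)` is a Bailey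
pair relative to `q`. -/
theorem bailey_pairs_prop3 : IsBaileyPair 1 a b ∧ IsBaileyPair q α β := by
  exact ⟨part_one, part_two⟩
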